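/- arXiv:2103.02110 — 7 statements merged into one kernel-verified Lean document; each statement's English description precedes it below -/
import Mathlib

section
/- Let p and q be distinct primes and n = p·q. Then every unit w of the ring ZMod (n^2) satisfies w^(n · Nat.lcm (p−1) (q−1)) = 1. -/
theorem paillier_unit_annihilation (p q : ℕ) (hp : p.Prime) (hq : q.Prime)
    (hpq : p ≠ q) (n : ℕ) (hn : n = p * q) (w : (ZMod (n ^ 2))ˣ) :
    w ^ (n * Nat.lcm (p - 1) (q - 1)) = 1 := by
  have hd : ArithmeticFunction.carmichael (n ^ 2) ∣ n * Nat.lcm (p - 1) (q - 1) := by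
    have hc : Nat.Coprime (p ^ 2) (q ^ 2) :=
      Nat.Coprime.pow _ _ ((Nat.coprime_primes hp hq).2 hpq)
    rw [hn, mul_pow, ArithmeticFunction.carmichael_mul hc]
    apply Nat.lcm_dvd
    · refine (ArithmeticFunction.carmichael_dvd_totient _).trans ?_
      rw [Nat.totient_prime_pow hp (by norm_num)]
      simp only [Nat.add_one_sub_one, pow_one]
      exact mul_dvd_mul (Dvd.intro _ rfl) (Nat.dvd_lcm_left _ _)
    · refine (ArithmeticFunction.carmichael_dvd_totient _).trans ?_
      rw [Nat.totient_prime_pow hq (by norm_num)]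
      simp only [Nat.add_one_sub_one, pow_one]
      exact mul_dvd_mul (Dvd.intro_left _ rfl) (Nat.dvd_lcm_right _ _)
  obtain ⟨k, hk⟩ := hd
  rw [hk, pow_mul, ArithmeticFunction.pow_carmichael, one_pow]
end

section
/- Under the Paillier setup, for every plaintext m : ℕ with m < n and every unit r of ZMod (n^2), decryption inverts encryption: D(E(m, r)) = m. -/
/-- Paillier encryption of the plaintext `m : ℕ` with randomness a unit `r` of
`ZMod (n ^ 2)`: `E(m, r) = (1 + n) ^ m * r ^ n` in `ZMod (n ^ 2)`. -/
def paillierEnc (n : ℕ) (m : ℕ) (r : (ZMod (n ^ 2))ˣ) : ZMod (n ^ 2) :=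
  (1 + (n : ZMod (n ^ 2))) ^ m * (r : ZMod (n ^ 2)) ^ n

/-- Paillier decryption of the ciphertext `c : ZMod (n ^ 2)`:
`D(c) = (((c ^ λ).val - 1) / n * μ) % n`. -/
def paillierDec (n lam μ : ℕ) (c : ZMod (n ^ 2)) : ℕ :=
  ((c ^ lam).val - 1) / n * μ % n

lemma paillier_aux_pow (n : ℕ) (k : ZMod (n ^ 2)) (j : ℕ) :
    (1 + (n : ZMod (n ^ 2)) * k) ^ j = 1 + (j : ZMod (n ^ 2)) * ((n : ZMod (n ^ 2)) * k) := by
  have h0 : (n : ZMod (n ^ 2)) ^ 2 = 0 := by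
    have := ZMod.natCast_self (n ^ 2)
    push_cast at this
    exact this
  induction j with
  | zero => simp
  | succ j ih =>
    rw [pow_succ (1 + (n : ZMod (n ^ 2)) * k) j, ih]
    push_cast
    linear_combination (j * k ^ 2 : ZMod (n ^ 2)) * h0

lemma paillier_aux_prime (p x lam : ℕ) (hp : p.Prime) (hx : Nat.Coprime x p)
    (hd : p - 1 ∣ lam) : x ^ lam ≡ 1 [MOD p] := by
  obtain ⟨t, rfl⟩ := hd
  have := (Nat.ModEq.pow_totient hx).pow t
  rwa [Nat.totient_prime hp, one_pow, ← pow_mul] at this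

theorem paillier_decrypt_encrypt (p q : ℕ) (hp : p.Prime) (hq : q.Prime) (hpq : p ≠ q)
    (hgcd : Nat.gcd (p * q) ((p - 1) * (q - 1)) = 1)
    (n lam μ : ℕ) (hn : n = p * q) (hlam : lam = Nat.lcm (p - 1) (q - 1))
    (hμ : μ * lam ≡ 1 [MOD n])
    (m : ℕ) (hm : m < n) (r : (ZMod (n ^ 2))ˣ) :
    paillierDec n lam μ (paillierEnc n m r) = m := by
  have hn1 : 1 < n := by
    rw [hn]; nlinarith [hp.two_le, hq.two_le]
  have h0 : (n : ZMod (n ^ 2)) ^ 2 = 0 := by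
    have := ZMod.natCast_self (n ^ 2)
    push_cast at this
    exact this
  haveI : NeZero (n ^ 2) := ⟨by positivity⟩
  have hr : ((r : ZMod (n ^ 2)) ^ n) ^ lam = 1 := by
    have hc : Nat.Coprime (r : ZMod (n ^ 2)).val n :=
      (ZMod.val_coe_unit_coprime r).coprime_dvd_right (dvd_pow_self n two_ne_zero)
    have hx : (((r : ZMod (n ^ 2)).val : ℕ) : ZMod (n ^ 2)) = r := ZMod.natCast_zmod_val _
    generalize (r : ZMod (n ^ 2)).val = x at hc hx
    have h1 : x ^ lam ≡ 1 [MOD n] := by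
      rw [hn, ← Nat.modEq_and_modEq_iff_modEq_mul ((Nat.coprime_primes hp hq).2 hpq)]
      rw [hn] at hc
      exact ⟨paillier_aux_prime p x lam hp (hc.coprime_dvd_right ⟨q, rfl⟩)
          (hlam ▸ Nat.dvd_lcm_left _ _),
        paillier_aux_prime q x lam hq (hc.coprime_dvd_right ⟨p, mul_comm _ _⟩)
          (hlam ▸ Nat.dvd_lcm_right _ _)⟩
    obtain ⟨k, hk⟩ := h1.symm.dvd
    have hk' : (r : ZMod (n ^ 2)) ^ lam = 1 + n * (k : ZMod (n ^ 2)) := by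
      have := congrArg (Int.cast : ℤ → ZMod (n ^ 2)) hk
      push_cast at this
      rw [hx] at this
      linear_combination this
    rw [pow_right_comm, hk', paillier_aux_pow]
    linear_combination (k : ZMod (n ^ 2)) * h0
  have hcl : (paillierEnc n m r) ^ lam = ((1 + n * (m * lam % n) : ℕ) : ZMod (n ^ 2)) := by
    have h2 := paillier_aux_pow n 1 (m * lam)
    rw [mul_one] at h2
    unfold paillierEnc
    rw [mul_pow, hr, mul_one, ← pow_mul, h2]
    have h3 := congrArg (Nat.cast : ℕ → ZMod (n ^ 2)) (Nat.div_add_mod (m * lam) n)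
    push_cast at h3 ⊢
    linear_combination (-(n : ZMod (n ^ 2))) * h3 + ((m * lam / n : ℕ) : ZMod (n ^ 2)) * h0
  have hlt : m * lam % n < n := Nat.mod_lt _ (by omega)
  have hlt2 : 1 + n * (m * lam % n) < n ^ 2 := by nlinarith
  unfold paillierDec
  rw [hcl, ZMod.val_natCast, Nat.mod_eq_of_lt hlt2, Nat.add_sub_cancel_left,
    Nat.mul_div_cancel_left _ (by omega)]
  have h4 : m * lam % n * μ ≡ m [MOD n] := by
    calc m * lam % n * μ ≡ m * lam * μ [MOD n] := (Nat.mod_modEq _ _).mul_right _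
      _ = m * (μ * lam) := by ring
      _ ≡ m * 1 [MOD n] := hμ.mul_left _
      _ = m := mul_one m
  exact Nat.mod_eq_of_modEq h4 hm
end

section
/- Under the Paillier setup, for a finite family of plaintexts m : Fin k → ℕ with ∑ℓ m ℓ < n and a family of units r : Fin k → (ZMod (n^2))ˣ, decrypting the product of all ciphertexts yields the sum of all plaintexts: D(∏ℓ E(m ℓ, r ℓ)) = ∑ℓ m ℓ. (This is the aggregation identity D(∏ℓ E(m_ℓ)) = ∑ℓ m_ℓ used in Step 6 of the paradigm.) -/
theorem paillier_one_add_pow (n j : ℕ) :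
    (1 + (n : ZMod (n ^ 2))) ^ j = 1 + (j : ZMod (n ^ 2)) * n := by
  have h0 : (n : ZMod (n ^ 2)) * n = 0 := by
    have := ZMod.natCast_self (n ^ 2)
    rw [← this]; push_cast; ring
  induction j with
  | zero => simp
  | succ j ih =>
    rw [pow_succ (1 + (n : ZMod (n ^ 2))) j, ih]; push_cast
    linear_combination (j : ZMod (n ^ 2)) * h0

theorem paillier_modEq_aux (p x e : ℕ) (hp : p.Prime) (hx : x.Coprime p)
    (he : p * (p - 1) ∣ e) : x ^ e ≡ 1 [MOD p ^ 2] := by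
  obtain ⟨d, rfl⟩ := he
  have h := Nat.ModEq.pow_totient (hx.pow_right 2)
  rw [Nat.totient_prime_pow hp (by norm_num)] at h
  have h2 := h.pow d
  rw [← pow_mul, one_pow] at h2
  simpa using h2

theorem paillier_unit_pow (p q : ℕ) (hp : p.Prime) (hq : q.Prime) (hpq : p ≠ q)
    (u : (ZMod ((p * q) ^ 2))ˣ) :
    (u : ZMod ((p * q) ^ 2)) ^ (p * q * Nat.lcm (p - 1) (q - 1)) = 1 := by
  have : NeZero ((p * q) ^ 2) := ⟨pow_ne_zero _ (mul_ne_zero hp.ne_zero hq.ne_zero)⟩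
  have hc := ZMod.val_coe_unit_coprime u
  have hc' : (u : ZMod ((p * q) ^ 2)).val.Coprime (p * q) :=
    (Nat.coprime_pow_right_iff (by norm_num) _ _).1 hc
  have h1 := paillier_modEq_aux p _ (p * q * Nat.lcm (p - 1) (q - 1)) hp
    (Nat.Coprime.coprime_mul_right_right hc')
    (mul_dvd_mul (dvd_mul_right p q) (Nat.dvd_lcm_left _ _))
  have h2 := paillier_modEq_aux q _ (p * q * Nat.lcm (p - 1) (q - 1)) hq
    (Nat.Coprime.coprime_mul_left_right hc')
    (mul_dvd_mul (dvd_mul_left q p) (Nat.dvd_lcm_right _ _))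
  have hco : (p ^ 2).Coprime (q ^ 2) := ((Nat.coprime_primes hp hq).2 hpq).pow 2 2
  have h3 := (Nat.modEq_and_modEq_iff_modEq_mul hco).1 ⟨h1, h2⟩
  rw [← mul_pow] at h3
  have h4 := (ZMod.natCast_eq_natCast_iff _ _ _).2 h3
  simpa using h4

theorem paillier_aggregation (p q : ℕ) (hp : p.Prime) (hq : q.Prime)
    (hpq : p ≠ q) (hgcd : Nat.gcd (p * q) ((p - 1) * (q - 1)) = 1)
    (n lam μ : ℕ) (hn : n = p * q) (hlam : lam = Nat.lcm (p - 1) (q - 1))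
    (hμ : μ * lam ≡ 1 [MOD n])
    (k : ℕ) (m : Fin k → ℕ) (hm : ∑ ℓ, m ℓ < n) (r : Fin k → (ZMod (n ^ 2))ˣ) :
    paillierDec n lam μ (∏ ℓ, paillierEnc n (m ℓ) (r ℓ)) = ∑ ℓ, m ℓ := by
  have hprod : ∏ ℓ, paillierEnc n (m ℓ) (r ℓ)
      = (1 + (n : ZMod (n ^ 2))) ^ (∑ ℓ, m ℓ) * ((∏ ℓ, r ℓ : (ZMod (n ^ 2))ˣ) : ZMod (n ^ 2)) ^ n := by
    simp only [paillierEnc, Finset.prod_mul_distrib, Finset.prod_pow_eq_pow_sum,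
      Finset.prod_pow, Units.coe_prod]
  generalize ∑ ℓ, m ℓ = S at *
  generalize ∏ ℓ, r ℓ = u at *
  have hu : (u : ZMod (n ^ 2)) ^ (n * lam) = 1 := by
    subst hn hlam
    exact paillier_unit_pow p q hp hq hpq u
  have hn2 : 2 ≤ n := by
    have := hp.two_le
    have := hq.two_le
    rw [hn]; nlinarith
  have hpos : 0 < n := by omega
  rw [hprod, paillierDec, mul_pow, ← pow_mul, ← pow_mul, hu, mul_one, paillier_one_add_pow]
  have hcast : (1 : ZMod (n ^ 2)) + ((S * lam : ℕ) : ZMod (n ^ 2)) * n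
      = ((1 + (S * lam % n) * n : ℕ) : ZMod (n ^ 2)) := by
    have h : 1 + (S * lam) * n ≡ 1 + (S * lam % n) * n [MOD n ^ 2] := by
      rw [pow_two]
      exact ((Nat.mod_modEq (S * lam) n).symm.mul_right' n).add_left 1
    have h' := (ZMod.natCast_eq_natCast_iff _ _ _).2 h
    rw [← h']; push_cast; ring
  have hlt : 1 + (S * lam % n) * n < n ^ 2 := by
    have := Nat.mod_lt (S * lam) hpos
    nlinarith
  rw [hcast, ZMod.val_natCast_of_lt hlt, Nat.add_sub_cancel_left, Nat.mul_div_cancel _ hpos]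
  have hfin : S * lam % n * μ ≡ S [MOD n] := by
    calc S * lam % n * μ ≡ S * lam * μ [MOD n] := (Nat.mod_modEq _ _).mul_right μ
      _ = S * (μ * lam) := by ring
      _ ≡ S * 1 [MOD n] := hμ.mul_left S
      _ = S := mul_one S
  rw [hfin, Nat.mod_eq_of_lt hm]
end

section
/- Under the Paillier setup, Paillier encryption is multiplicatively semi-homomorphic: for plaintexts m₁, m₂ : ℕ with m₁ · m₂ < n and a unit r of ZMod (n^2), decrypting the ciphertext E(m₁, r) raised to the plaintext power m₂ yields the product of the plaintexts, i.e. D(E(m₁, r)^{m₂}) = m₁ · m₂. -/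
/-- First-order binomial expansion for an element with square zero. -/
theorem paillier_one_add_pow_s5 {R : Type*} [CommRing R] (N t : R) (hN : N ^ 2 = 0) (k : ℕ) :
    (1 + N * t) ^ k = 1 + N * (k * t) := by
  induction k with
  | zero => simp
  | succ k ih =>
    rw [pow_succ, ih]
    push_cast
    linear_combination (k * t ^ 2) * hN

theorem paillier_fermat (p a l : ℕ) (hp : p.Prime) (ha : Nat.Coprime a p) (hl : p - 1 ∣ l) :
    a ^ l ≡ 1 [MOD p] := by
  obtain ⟨k, rfl⟩ := hl
  have h := (Nat.ModEq.pow_totient ha).pow k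
  rwa [Nat.totient_prime hp, ← pow_mul, one_pow] at h

theorem paillier_multiplicatively_semihomomorphic (p q : ℕ) (hp : p.Prime) (hq : q.Prime)
    (hpq : p ≠ q) (hgcd : Nat.gcd (p * q) ((p - 1) * (q - 1)) = 1)
    (n lam μ : ℕ) (hn : n = p * q) (hlam : lam = Nat.lcm (p - 1) (q - 1))
    (hμ : μ * lam ≡ 1 [MOD n])
    (m₁ m₂ : ℕ) (hm : m₁ * m₂ < n) (r : (ZMod (n ^ 2))ˣ) :
    paillierDec n lam μ (paillierEnc n m₁ r ^ m₂) = m₁ * m₂ := by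
  have hn1 : 1 < n := by
    rw [hn]; exact Nat.one_lt_mul_iff.mpr ⟨hp.pos, hq.pos, Or.inl hp.one_lt⟩
  haveI : NeZero (n ^ 2) := ⟨by positivity⟩
  have hN : (n : ZMod (n ^ 2)) ^ 2 = 0 := by
    have := ZMod.natCast_self (n ^ 2)
    rwa [Nat.cast_pow] at this
  have hcop : Nat.Coprime (r : ZMod (n ^ 2)).val n :=
    Nat.Coprime.coprime_dvd_right (dvd_pow_self n two_ne_zero) (ZMod.val_coe_unit_coprime r)
  have hmod : (r : ZMod (n ^ 2)).val ^ lam ≡ 1 [MOD n] := by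
    have h1 := paillier_fermat p (r : ZMod (n ^ 2)).val lam hp
      (hcop.coprime_dvd_right ⟨q, hn⟩) (hlam ▸ Nat.dvd_lcm_left _ _)
    have h2 := paillier_fermat q (r : ZMod (n ^ 2)).val lam hq
      (hcop.coprime_dvd_right ⟨p, by rw [hn, mul_comm]⟩) (hlam ▸ Nat.dvd_lcm_right _ _)
    have h3 := (Nat.modEq_and_modEq_iff_modEq_mul ((Nat.coprime_primes hp hq).mpr hpq)).mp ⟨h1, h2⟩
    exact hn.symm ▸ h3
  have hr : ((r : ZMod (n ^ 2)) ^ lam) ^ n = 1 := by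
    obtain ⟨t, ht⟩ := (Nat.modEq_iff_dvd.mp hmod.symm)
    have h4 : (r : ZMod (n ^ 2)) ^ lam = 1 + (n : ZMod (n ^ 2)) * (t : ZMod (n ^ 2)) := by
      have h5 := congrArg (Int.cast : ℤ → ZMod (n ^ 2)) ht
      push_cast at h5
      rw [ZMod.natCast_zmod_val] at h5
      linear_combination h5
    rw [h4, paillier_one_add_pow_s5 _ _ hN]
    linear_combination (t : ZMod (n ^ 2)) * hN
  have hc : (paillierEnc n m₁ r ^ m₂) ^ lam
      = ((1 + n * ((m₁ * m₂ * lam) % n) : ℕ) : ZMod (n ^ 2)) := by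
    have e : (paillierEnc n m₁ r ^ m₂) ^ lam
        = (1 + (n : ZMod (n ^ 2)) * 1) ^ (m₁ * m₂ * lam)
          * (((r : ZMod (n ^ 2)) ^ lam) ^ n) ^ m₂ := by
      unfold paillierEnc
      ring
    rw [e, hr, one_pow, mul_one, paillier_one_add_pow_s5 _ _ hN]
    have h6 := congrArg (Nat.cast : ℕ → ZMod (n ^ 2)) (Nat.mod_add_div (m₁ * m₂ * lam) n)
    rw [← h6]
    push_cast
    linear_combination ((m₁ * m₂ * lam / n : ℕ) : ZMod (n ^ 2)) * hN
  have hlt : 1 + n * ((m₁ * m₂ * lam) % n) < n ^ 2 := by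
    have := Nat.mod_lt (m₁ * m₂ * lam) (by omega : 0 < n)
    nlinarith
  unfold paillierDec
  rw [hc, ZMod.val_natCast, Nat.mod_eq_of_lt hlt, Nat.add_sub_cancel_left,
    Nat.mul_div_cancel_left _ (by omega)]
  have h7 : (m₁ * m₂ * lam) % n * μ ≡ m₁ * m₂ [MOD n] := by
    calc (m₁ * m₂ * lam) % n * μ ≡ m₁ * m₂ * lam * μ [MOD n] :=
          (Nat.mod_modEq _ _).mul_right _
      _ = m₁ * m₂ * (μ * lam) := by ring
      _ ≡ m₁ * m₂ * 1 [MOD n] := hμ.mul_left _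
      _ = m₁ * m₂ := mul_one _
  rw [h7, Nat.mod_eq_of_lt hm]
end

section
/- Under the Paillier setup, the decryption of an aggregated ciphertext depends only on the sum of the plaintexts modulo n and not on the individual summands or the randomness: for two families of plaintexts m, m' : Fin k → ℕ and two families of units r, r' : Fin k → (ZMod (n^2))ˣ, if ∑ℓ m ℓ ≡ ∑ℓ m' ℓ (mod n), then D(∏ℓ E(m ℓ, r ℓ)) = D(∏ℓ E(m' ℓ, r' ℓ)). (This is the algebraic core of the simulator construction in the proof of Theorem 1: any decomposition (A_{uj} x_j^k + γ_j^k c)' with the same total sum and freshly sampled randomness produces a ciphertext whose decryption equals the true aggregate z_c^k.) -/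
theorem paillier_aux_pow_s6 (n : ℕ) (a : ℕ) (h : a ≡ 1 [MOD n]) :
    (a : ZMod (n ^ 2)) ^ n = 1 := by
  have h1 : (n : ℤ) ∣ (a : ℤ) - 1 := by
    have := (Nat.modEq_iff_dvd.mp h.symm)
    simpa using this
  have h2 := dvd_sub_pow_of_dvd_sub (R := ℤ) (p := n) h1 1
  have h3 : (((a : ℤ) ^ n - 1 : ℤ) : ZMod (n ^ 2)) = 0 := by
    rw [ZMod.intCast_zmod_eq_zero_iff_dvd]
    simpa using h2
  push_cast at h3
  exact sub_eq_zero.mp h3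

theorem paillier_aux_unit (p q : ℕ) (hp : p.Prime) (hq : q.Prime) (hpq : p ≠ q)
    (n lam : ℕ) (hn : n = p * q) (hlam : lam = Nat.lcm (p - 1) (q - 1))
    (r : (ZMod (n ^ 2))ˣ) : ((r : ZMod (n ^ 2)) ^ n) ^ lam = 1 := by
  have hn0 : n ≠ 0 := by
    rw [hn]; exact mul_ne_zero hp.ne_zero hq.ne_zero
  haveI : NeZero (n ^ 2) := ⟨pow_ne_zero 2 hn0⟩
  have hc := ZMod.val_coe_unit_coprime r
  have key : ∀ s : ℕ, s.Prime → s ∣ n → s - 1 ∣ lam →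
      (r : ZMod (n ^ 2)).val ^ lam ≡ 1 [MOD s] := by
    intro s hs hsn hsl
    obtain ⟨t, ht⟩ := hsl
    have h1 : Nat.Coprime (r : ZMod (n ^ 2)).val s :=
      hc.coprime_dvd_right (hsn.trans (dvd_pow_self n two_ne_zero))
    have h2 := Nat.ModEq.pow_totient h1
    rw [Nat.totient_prime hs] at h2
    rw [ht, pow_mul]
    simpa using h2.pow t
  have hA := key p hp (hn ▸ dvd_mul_right p q) (hlam ▸ Nat.dvd_lcm_left _ _)
  have hB := key q hq (hn ▸ dvd_mul_left q p) (hlam ▸ Nat.dvd_lcm_right _ _)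
  have hAB : (r : ZMod (n ^ 2)).val ^ lam ≡ 1 [MOD n] := by
    have := (Nat.modEq_and_modEq_iff_modEq_mul ((Nat.coprime_primes hp hq).2 hpq)).1 ⟨hA, hB⟩
    rwa [← hn] at this
  have := paillier_aux_pow_s6 n _ hAB
  rw [Nat.cast_pow, ZMod.natCast_zmod_val] at this
  rw [← pow_mul, mul_comm, pow_mul]
  exact this

theorem paillier_simulator_core (p q : ℕ) (hp : p.Prime) (hq : q.Prime)
    (hpq : p ≠ q) (hgcd : Nat.gcd (p * q) ((p - 1) * (q - 1)) = 1)
    (n lam μ : ℕ) (hn : n = p * q) (hlam : lam = Nat.lcm (p - 1) (q - 1))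
    (hμ : μ * lam ≡ 1 [MOD n])
    (k : ℕ) (m m' : Fin k → ℕ) (r r' : Fin k → (ZMod (n ^ 2))ˣ)
    (hsum : (∑ ℓ, m ℓ) ≡ (∑ ℓ, m' ℓ) [MOD n]) :
    paillierDec n lam μ (∏ ℓ, paillierEnc n (m ℓ) (r ℓ)) =
      paillierDec n lam μ (∏ ℓ, paillierEnc n (m' ℓ) (r' ℓ)) := by
  have hg : (1 + (n : ZMod (n ^ 2))) ^ n = 1 := by
    have := paillier_aux_pow_s6 n (1 + n) (by simp [Nat.ModEq])
    simpa using this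
  have hred : ∀ a : ℕ, (1 + (n : ZMod (n ^ 2))) ^ a = (1 + (n : ZMod (n ^ 2))) ^ (a % n) := by
    intro a
    conv_lhs => rw [← Nat.mod_add_div a n, pow_add, pow_mul, hg, one_pow, mul_one]
  have hprod : ∀ (f : Fin k → ℕ) (s : Fin k → (ZMod (n ^ 2))ˣ),
      (∏ ℓ, paillierEnc n (f ℓ) (s ℓ)) ^ lam
        = ((1 + (n : ZMod (n ^ 2))) ^ ((∑ ℓ, f ℓ) % n)) ^ lam := by
    intro f s
    unfold paillierEnc
    rw [Finset.prod_mul_distrib, mul_pow, Finset.prod_pow_eq_pow_sum, ← hred,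
      ← Finset.prod_pow, Finset.prod_eq_one, mul_one]
    intro ℓ _
    exact paillier_aux_unit p q hp hq hpq n lam hn hlam (s ℓ)
  unfold paillierDec
  rw [hprod m r, hprod m' r', show (∑ ℓ, m ℓ) % n = (∑ ℓ, m' ℓ) % n from hsum]
end

section
/- Under the Paillier setup, encryption is injective on plaintexts below n: if m₁, m₂ : ℕ satisfy m₁ < n and m₂ < n, and there exist units r₁, r₂ of ZMod (n^2) with E(m₁, r₁) = E(m₂, r₂), then m₁ = m₂. -/
theorem one_add_pow_aux (n k : ℕ) :
    (1 + (n : ZMod (n ^ 2))) ^ k = ((1 + k * n : ℕ) : ZMod (n ^ 2)) := by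
  have h0 : (n : ZMod (n ^ 2)) ^ 2 = 0 := by
    have := ZMod.natCast_self (n ^ 2)
    push_cast at this
    exact this
  induction k with
  | zero => simp
  | succ k ih =>
    rw [pow_succ (1 + (n : ZMod (n ^ 2))) k, ih]
    push_cast
    linear_combination (k : ZMod (n ^ 2)) * h0

theorem paillier_enc_injective (p q : ℕ) (hp : p.Prime) (hq : q.Prime)
    (hpq : p ≠ q) (hgcd : Nat.gcd (p * q) ((p - 1) * (q - 1)) = 1)
    (n lam μ : ℕ) (hn : n = p * q) (hlam : lam = Nat.lcm (p - 1) (q - 1))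
    (hμ : μ * lam ≡ 1 [MOD n])
    (m₁ m₂ : ℕ) (hm₁ : m₁ < n) (hm₂ : m₂ < n)
    (h : ∃ r₁ r₂ : (ZMod (n ^ 2))ˣ, paillierEnc n m₁ r₁ = paillierEnc n m₂ r₂) :
    m₁ = m₂ := by
  obtain ⟨r₁, r₂, h⟩ := h
  have hn0 : 0 < n := by omega
  have htot : Nat.totient (n ^ 2) = n * ((p - 1) * (q - 1)) := by
    rw [hn, mul_pow,
      Nat.totient_mul (((Nat.coprime_primes hp hq).2 hpq).pow 2 2),
      Nat.totient_prime_pow hp two_pos, Nat.totient_prime_pow hq two_pos]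
    ring
  have hr : ∀ r : (ZMod (n ^ 2))ˣ,
      ((r : ZMod (n ^ 2)) ^ n) ^ ((p - 1) * (q - 1)) = 1 := by
    intro r
    rw [← pow_mul, ← htot]
    have := ZMod.pow_totient r
    rw [← Units.val_pow_eq_pow_val, this, Units.val_one]
  have h2 := congrArg (fun x => x ^ ((p - 1) * (q - 1))) h
  simp only [paillierEnc, mul_pow, hr, mul_one] at h2
  rw [← pow_mul, ← pow_mul, one_add_pow_aux, one_add_pow_aux,
    ZMod.natCast_eq_natCast_iff] at h2
  have h3 := Nat.ModEq.add_left_cancel' 1 h2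
  rw [sq] at h3
  have h4 := Nat.ModEq.mul_right_cancel' hn0.ne' h3
  rw [← hn] at hgcd
  have h5 := Nat.ModEq.cancel_right_of_coprime hgcd h4
  exact Nat.ModEq.eq_of_lt_of_lt h5 hm₁ hm₂
end

section
/- Let p be an odd natural number with p ≥ 3, let σ : ℕ be a precision level, and let r_e : ℝ be a real number such that 10^σ · r_e equals an integer m with |m| ≤ (p−1)/2. Let v := ((m : ZMod p)).val. Define T_{σ,p}(v) := (v : ℝ)/10^σ if v ≤ (p−1)/2, and T_{σ,p}(v) := ((v : ℝ) − p)/10^σ otherwise. Then T_{σ,p}(v) = r_e. -/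
theorem real_round_trip_exact (p : ℕ) (hodd : Odd p) (hp : 3 ≤ p)
    (σ : ℕ) (r_e : ℝ) (m : ℤ) (hscale : (10 : ℝ) ^ σ * r_e = (m : ℝ))
    (hm : |m| ≤ ((p - 1) / 2 : ℕ)) :
    (if ((m : ZMod p)).val ≤ (p - 1) / 2 then
        ((((m : ZMod p)).val : ℝ)) / 10 ^ σ
      else
        ((((m : ZMod p)).val : ℝ) - (p : ℝ)) / 10 ^ σ) = r_e := by
  have h10 : (10 : ℝ) ^ σ ≠ 0 := by positivity
  haveI : NeZero p := ⟨by omega⟩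
  have hv : (((m : ZMod p).val : ℕ) : ℤ) = m % (p : ℤ) := ZMod.val_intCast m
  obtain ⟨k, hk⟩ := hodd
  obtain ⟨h1, h2⟩ := abs_le.mp hm
  generalize (m : ZMod p).val = v at hv ⊢
  have hmod : m % (p : ℤ) = if 0 ≤ m then m else m + p := by
    split_ifs with h
    · exact Int.emod_eq_of_lt h (by omega)
    · rw [← Int.add_emod_right]
      exact Int.emod_eq_of_lt (by omega) (by omega)
  rw [hmod] at hv
  split_ifs with hc
  · have : (v : ℤ) = m := by split_ifs at hv <;> omega
    have h3 : (v : ℝ) = m := by exact_mod_cast this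
    rw [div_eq_iff h10, h3, ← hscale, mul_comm]
  · have : (v : ℤ) - p = m := by split_ifs at hv <;> omega
    have h3 : (v : ℝ) - p = m := by exact_mod_cast this
    rw [div_eq_iff h10, h3, ← hscale, mul_comm]
end
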